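/- arXiv:2112.13892 — 2 statements merged into one kernel-verified Lean document; each statement's English description precedes it below -/
import Mathlib

section
/- Let (d; m_1, m_2, m_3, m_4) be a 4-point monodromy datum. For each integer e with 1 ≤ e ≤ d−1 one has F(e) = F(d−e), where F(e) = α_e/d if σ_e = 2 and α_e + φ_e ≤ 1, F(e) = (1 − φ_e)/d if σ_e = 2 and α_e + φ_e > 1, and F(e) = 0 otherwise. (This is the arithmetic expression of the symmetry λ_1^e = λ_1^{d−e} from Lemma 2.10 combined with Theorem 1.1.) -/
open Finset

/-- The age `⟨e mᵢ / d⟩`: the fractional part of `e mᵢ / d`. -/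
noncomputable def age (d e mi : ℤ) : ℚ := Int.fract ((e * mi : ℚ) / (d : ℚ))

/-- The sum of ages `σ_e`. -/
noncomputable def sigmaE (d e : ℤ) (m : Fin 4 → ℤ) : ℚ := ∑ i, age d e (m i)

/-- The smallest age `α_e`. -/
noncomputable def alphaE (d e : ℤ) (m : Fin 4 → ℤ) : ℚ :=
  min (min (age d e (m 0)) (age d e (m 1))) (min (age d e (m 2)) (age d e (m 3)))

/-- The largest age `φ_e`. -/
noncomputable def phiE (d e : ℤ) (m : Fin 4 → ℤ) : ℚ :=
  max (max (age d e (m 0)) (age d e (m 1))) (max (age d e (m 2)) (age d e (m 3)))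

/-- The arithmetic formula `F(e)` for the degree of the Hurwitz-Hodge class `λ₁ᵉ`. -/
noncomputable def F (d e : ℤ) (m : Fin 4 → ℤ) : ℚ :=
  if sigmaE d e m = 2 then
    if alphaE d e m + phiE d e m ≤ 1 then alphaE d e m / (d : ℚ)
    else (1 - phiE d e m) / (d : ℚ)
  else 0

theorem age_nonneg (d e a : ℤ) : 0 ≤ age d e a := Int.fract_nonneg _

theorem age_lt_one (d e a : ℤ) : age d e a < 1 := Int.fract_lt_one _

theorem age_complement_eq_fract_neg {d : ℤ} (hd : d ≠ 0) (e a : ℤ) :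
    age d (d - e) a = Int.fract (-((e * a : ℚ) / (d : ℚ))) := by
  have hd' : (d : ℚ) ≠ 0 := Int.cast_ne_zero.mpr hd
  have h : (((d - e : ℤ) : ℚ) * a) / d = a + -((e * a : ℚ) / d) := by
    push_cast
    field_simp
    ring
  rw [age, h, Int.fract_intCast_add]

theorem age_complement_of_age_eq_zero {d : ℤ} (hd : d ≠ 0) {e a : ℤ} (h : age d e a = 0) :
    age d (d - e) a = 0 := by
  rw [age_complement_eq_fract_neg hd]
  exact Int.fract_neg_eq_zero.mpr h

theorem age_complement_of_age_ne_zero {d : ℤ} (hd : d ≠ 0) {e a : ℤ} (h : age d e a ≠ 0) :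
    age d (d - e) a = 1 - age d e a := by
  rw [age_complement_eq_fract_neg hd]
  exact Int.fract_neg h

theorem F_eq_ite_min (d e : ℤ) (m : Fin 4 → ℤ) :
    F d e m = if sigmaE d e m = 2 then min (alphaE d e m) (1 - phiE d e m) / (d : ℚ) else 0 := by
  simp only [F, ← le_sub_iff_add_le]
  split_ifs with _ h
  · rw [min_eq_left h]
  · rw [min_eq_right (not_le.mp h).le]
  · rfl

theorem alphaE_le_age (d e : ℤ) (m : Fin 4 → ℤ) (i : Fin 4) : alphaE d e m ≤ age d e (m i) := by
  fin_cases i <;> simp [alphaE]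

theorem alphaE_nonneg (d e : ℤ) (m : Fin 4 → ℤ) : 0 ≤ alphaE d e m := by
  simp [alphaE, age_nonneg]

theorem phiE_lt_one (d e : ℤ) (m : Fin 4 → ℤ) : phiE d e m < 1 := by
  simp [phiE, age_lt_one]

theorem F_eq_zero_of_age_eq_zero {d e : ℤ} {m : Fin 4 → ℤ} {i : Fin 4} (h : age d e (m i) = 0) :
    F d e m = 0 := by
  have hα : alphaE d e m = 0 := le_antisymm (h ▸ alphaE_le_age d e m i) (alphaE_nonneg d e m)
  rw [F_eq_ite_min, hα, min_eq_left (sub_nonneg.mpr (phiE_lt_one d e m).le), zero_div, ite_self]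

theorem degree_symmetry_F_eq_F_of_complement
    (d : ℤ) (hd : 1 ≤ d) (m : Fin 4 → ℤ)
    (hm0 : ∀ i, 0 ≤ m i) (hm1 : ∀ i, m i < d)
    (hsum : d ∣ ∑ i, m i)
    (hgcd : Int.gcd (m 0) (Int.gcd (m 1) (Int.gcd (m 2) (Int.gcd (m 3) d))) = 1)
    (e : ℤ) (he : 1 ≤ e) (he' : e ≤ d - 1) :
    F d e m = F d (d - e) m := by
  have hd0 : d ≠ 0 := by omega
  by_cases h : ∃ i, age d e (m i) = 0
  · obtain ⟨i, hi⟩ := h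
    rw [F_eq_zero_of_age_eq_zero hi,
      F_eq_zero_of_age_eq_zero (age_complement_of_age_eq_zero hd0 hi)]
  · push Not at h
    have hage : ∀ i, age d (d - e) (m i) = 1 - age d e (m i) := fun i =>
      age_complement_of_age_ne_zero hd0 (h i)
    have hσ : sigmaE d (d - e) m = 4 - sigmaE d e m := by
      simp only [sigmaE, hage, Fin.sum_univ_four]
      ring
    have hα : alphaE d (d - e) m = 1 - phiE d e m := by
      simp only [alphaE, phiE, hage, min_sub_sub_left]
    have hφ : phiE d (d - e) m = 1 - alphaE d e m := by
      simp only [alphaE, phiE, hage, max_sub_sub_left]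
    have hiff : 4 - sigmaE d e m = 2 ↔ sigmaE d e m = 2 := by
      constructor <;> intro h <;> linarith
    rw [F_eq_ite_min, F_eq_ite_min, hσ, hα, hφ, sub_sub_cancel, min_comm]
    simp only [hiff]
end

section
/- Let (d; m_1, m_2, m_3, m_4) be a 4-point monodromy datum. Then Σ_{I ⊆ {1,2,3,4}} (−1)^{|I|} · gcd(Σ_{i∈I} m_i, d)² ≥ 0. (This is the nonnegativity of the degree of λ_1 computed in Theorem 1.2, which follows since it equals a sum of the nonnegative degrees of the classes λ_1^e.) -/
open Finset

/-- If `d` divides `a + b`, then `a` and `b` have the same gcd with `d`. -/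
lemma Int.gcd_eq_gcd_of_dvd_add {a b d : ℤ} (h : d ∣ a + b) : Int.gcd a d = Int.gcd b d := by
  obtain ⟨k, hk⟩ := h
  obtain rfl : a = -b + d * k := by linarith
  simp

/-- A residue `0 < a < d` has gcd at most `d / 2` with `d`. -/
lemma Int.two_mul_gcd_le {a d : ℤ} (ha : 0 < a) (had : a < d) : 2 * (Int.gcd a d : ℤ) ≤ d := by
  obtain ⟨k, hk⟩ := Int.gcd_dvd_right a d
  have hle : (Int.gcd a d : ℤ) ≤ a := Int.le_of_dvd ha (Int.gcd_dvd_left a d)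
  have hpos : (0 : ℤ) < Int.gcd a d := by
    exact_mod_cast Int.gcd_pos_of_ne_zero_left d ha.ne'
  have hk2 : 2 ≤ k := by
    by_contra! hk1
    nlinarith
  nlinarith

lemma sum_powerset_univ_fin_four (f : Finset (Fin 4) → ℤ) :
    ∑ I ∈ (Finset.univ : Finset (Fin 4)).powerset, f I =
      f ∅ + f {0} + f {1} + f {2} + f {3} + f {0, 1} + f {0, 2} + f {0, 3} + f {1, 2} + f {1, 3}
        + f {2, 3} + f {0, 1, 2} + f {0, 1, 3} + f {0, 2, 3} + f {1, 2, 3} + f {0, 1, 2, 3} := by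
  have h : (Finset.univ : Finset (Fin 4)).powerset =
      (({∅, {0}, {1}, {2}, {3}, {0, 1}, {0, 2}, {0, 3}, {1, 2}, {1, 3}, {2, 3}, {0, 1, 2},
        {0, 1, 3}, {0, 2, 3}, {1, 2, 3}, {0, 1, 2, 3}} : Finset (Finset (Fin 4)))) := by decide
  rw [h]
  iterate 15 rw [Finset.sum_insert (by decide)]
  rw [Finset.sum_singleton]
  ring

lemma sum_sq_gcd_le {d x y z w : ℤ} (hx : 0 ≤ x) (hy : 0 ≤ y) (hz : 0 ≤ z) (hw : 0 ≤ w)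
    (hxd : x < d) (hyd : y < d) (hzd : z < d) (hwd : w < d) (h : d ∣ x + y + z + w) :
    (Int.gcd x d : ℤ) ^ 2 + (Int.gcd y d : ℤ) ^ 2 + (Int.gcd z d : ℤ) ^ 2 + (Int.gcd w d : ℤ) ^ 2 ≤
      d ^ 2 + (Int.gcd (x + y) d : ℤ) ^ 2 + (Int.gcd (x + z) d : ℤ) ^ 2
        + (Int.gcd (y + z) d : ℤ) ^ 2 := by
  rcases hx.eq_or_lt with rfl | hx
  · have e : Int.gcd (y + z) d = Int.gcd w d := Int.gcd_eq_gcd_of_dvd_add (by simpa using h)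
    simp [e]
  rcases hy.eq_or_lt with rfl | hy
  · have e : Int.gcd (x + z) d = Int.gcd w d := Int.gcd_eq_gcd_of_dvd_add (by simpa using h)
    simp [e]; linarith
  rcases hz.eq_or_lt with rfl | hz
  · have e : Int.gcd (x + y) d = Int.gcd w d := Int.gcd_eq_gcd_of_dvd_add (by simpa using h)
    simp [e]; linarith
  rcases hw.eq_or_lt with rfl | hw
  · have e₁ : Int.gcd (x + y) d = Int.gcd z d := Int.gcd_eq_gcd_of_dvd_add (by simpa using h)
    have e₂ : Int.gcd (x + z) d = Int.gcd y d :=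
      Int.gcd_eq_gcd_of_dvd_add (by convert h using 1; ring)
    have e₃ : Int.gcd (y + z) d = Int.gcd x d :=
      Int.gcd_eq_gcd_of_dvd_add (by convert h using 1; ring)
    simp [e₁, e₂, e₃]; linarith
  have key : ∀ a : ℤ, 0 < a → a < d → 4 * (Int.gcd a d : ℤ) ^ 2 ≤ d ^ 2 := fun a ha had => by
    have := pow_le_pow_left₀ (by positivity) (Int.two_mul_gcd_le ha had) 2
    linarith [mul_pow 2 (Int.gcd a d : ℤ) 2]
  linarith [key x hx hxd, key y hy hyd, key z hz hzd, key w hw hwd,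
    sq_nonneg (Int.gcd (x + y) d : ℤ), sq_nonneg (Int.gcd (x + z) d : ℤ),
    sq_nonneg (Int.gcd (y + z) d : ℤ)]

theorem gcd_alternating_sum_nonneg
    (d : ℤ) (hd : 1 ≤ d) (m : Fin 4 → ℤ)
    (hm0 : ∀ i, 0 ≤ m i) (hm1 : ∀ i, m i < d)
    (hsum : d ∣ ∑ i, m i)
    (hgcd : Int.gcd (m 0) (Int.gcd (m 1) (Int.gcd (m 2) (Int.gcd (m 3) d))) = 1) :
    0 ≤ ∑ I ∈ (Finset.univ : Finset (Fin 4)).powerset,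
        (-1 : ℤ) ^ I.card * (Int.gcd (∑ i ∈ I, m i) d : ℤ) ^ 2 := by
  rw [Fin.sum_univ_four] at hsum
  have main := sum_sq_gcd_le (hm0 0) (hm0 1) (hm0 2) (hm0 3) (hm1 0) (hm1 1) (hm1 2) (hm1 3) hsum
  have compl : ∀ a b : ℤ, a + b = m 0 + m 1 + m 2 + m 3 → Int.gcd a d = Int.gcd b d :=
    fun a b hab => Int.gcd_eq_gcd_of_dvd_add (hab ▸ hsum)
  have e₀₃ := compl (m 0 + m 3) (m 1 + m 2) (by ring)
  have e₁₃ := compl (m 1 + m 3) (m 0 + m 2) (by ring)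
  have e₂₃ := compl (m 2 + m 3) (m 0 + m 1) (by ring)
  have e₀₁₂ := compl (m 0 + (m 1 + m 2)) (m 3) (by ring)
  have e₀₁₃ := compl (m 0 + (m 1 + m 3)) (m 2) (by ring)
  have e₀₂₃ := compl (m 0 + (m 2 + m 3)) (m 1) (by ring)
  have e₁₂₃ := compl (m 1 + (m 2 + m 3)) (m 0) (by ring)
  have e := compl (m 0 + (m 1 + (m 2 + m 3))) 0 (by ring)
  rw [sum_powerset_univ_fin_four]
  simp [e₀₃, e₁₃, e₂₃, e₀₁₂, e₀₁₃, e₀₂₃, e₁₂₃, e]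
  linarith
end
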